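/- Let d ≥ 1, let A ⊂ ℤ^d be a finite set whose convex hull H(A) is a d-simplex, and fix a_0 ∈ A. Then for every integer N ≥ (d+1)!·vol(H(A)) − (d+1)(|A| − d) + 1 (vol denoting d-dimensional Lebesgue volume), the structure equation (∗) holds: NA = (N·H(A) ∩ (N·a_0 + Λ_{A−A})) ∖ ⋃_{a ∈ ex(H(A))} (N·a − E(a−A)). -/

import Mathlib

open Pointwise MeasureTheory

noncomputable section

/-- Embedding of integer vectors into real vectors. -/
def emb (d : ℕ) : (Fin d → ℤ) → (Fin d → ℝ) := fun x i => (x i : ℝ)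

/-- The `N`-fold sumset `NA` (with `0·A = {0}`). -/
def nfold (d : ℕ) (A : Set (Fin d → ℤ)) (N : ℕ) : Set (Fin d → ℤ) :=
  {x | ∃ f : Fin N → (Fin d → ℤ), (∀ i, f i ∈ A) ∧ x = ∑ i, f i}

/-- `P(A) = ⋃_{N ≥ 1} NA`. -/
def PA (d : ℕ) (A : Set (Fin d → ℤ)) : Set (Fin d → ℤ) :=
  ⋃ N ∈ Set.Ici 1, nfold d A N

/-- The width `w(A) = max_{a₁,a₂ ∈ A} ‖a₁ - a₂‖_∞`. -/
def width (d : ℕ) (A : Finset (Fin d → ℤ)) : ℕ :=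
  (A ×ˢ A).sup fun p => Finset.univ.sup fun i => (p.1 i - p.2 i).natAbs

/-- The convex hull `H(A)` in `ℝ^d`. -/
def hull (d : ℕ) (A : Finset (Fin d → ℤ)) : Set (Fin d → ℝ) :=
  convexHull ℝ (emb d '' ↑A)

/-- The cone `C_B = {∑_{b ∈ B} c_b b : c_b ≥ 0}` generated by `B`. -/
def cone (d : ℕ) (B : Finset (Fin d → ℤ)) : Set (Fin d → ℝ) :=
  {x | ∃ c : (Fin d → ℤ) → ℝ, (∀ a, 0 ≤ c a) ∧ x = ∑ a ∈ B, c a • emb d a}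

/-- The lattice (subgroup of `ℤ^d`) generated by a set `S`. -/
def latt (d : ℕ) (S : Set (Fin d → ℤ)) : AddSubgroup (Fin d → ℤ) :=
  AddSubgroup.closure S

/-- The exceptional set `E(A) = (C_A ∩ Λ_A) ∖ P(A)`, viewed inside `ℤ^d`. -/
def excep (d : ℕ) (A : Finset (Fin d → ℤ)) : Set (Fin d → ℤ) :=
  {x | emb d x ∈ cone d A ∧ x ∈ latt d ↑A ∧ x ∉ PA d ↑A}

/-- The set of (lattice) extreme points of `H(A)`: those `p` with `emb p ∈ H(A)` such that
some `v ∈ span ℝ (A - A)`, `v ≠ 0`, satisfies `⟨v,x⟩ > ⟨v,p⟩` for all `x ∈ H(A) ∖ {p}`. -/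
def exP (d : ℕ) (A : Finset (Fin d → ℤ)) : Set (Fin d → ℤ) :=
  {p | emb d p ∈ hull d A ∧
    ∃ v ∈ Submodule.span ℝ (emb d '' ((A : Set (Fin d → ℤ)) - (A : Set (Fin d → ℤ)))),
      v ≠ (0 : Fin d → ℝ) ∧
      ∀ x ∈ hull d A, x ≠ emb d p → (∑ i, v i * emb d p i) < ∑ i, v i * x i}

/-- The structure equation
`NA = (N·H(A) ∩ (N·a₀ + Λ_{A-A})) ∖ ⋃_{a ∈ ex(H(A))} (N·a - E(a - A))`. -/
def structEq (d : ℕ) (A : Finset (Fin d → ℤ)) (a0 : Fin d → ℤ) (N : ℕ) : Prop :=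
  emb d '' nfold d ↑A N =
    ((N : ℝ) • hull d A ∩
      emb d '' (({N • a0} : Set (Fin d → ℤ)) +
        (latt d ((A : Set (Fin d → ℤ)) - (A : Set (Fin d → ℤ))) : Set (Fin d → ℤ)))) \
    ⋃ a ∈ exP d A,
      emb d '' (({N • a} : Set (Fin d → ℤ)) - excep d (A.image fun y => a - y))

/-- `H(A)` is a `d`-simplex: there is `B ⊆ A` with `|B| = d+1`, `B - B` spanning `ℝ^d`,
and `H(A) = H(B)`. -/
def IsSimplex (d : ℕ) (A : Finset (Fin d → ℤ)) : Prop :=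
  ∃ B ⊆ A, B.card = d + 1 ∧
    Submodule.span ℝ (emb d '' ((B : Set (Fin d → ℤ)) - (B : Set (Fin d → ℤ)))) = ⊤ ∧
    hull d B = hull d A

/-- `N_A(v)`: the minimal positive `N` with `v ∈ NA`, and `N_A(0) = 0`. -/
def NAfn (d : ℕ) (A : Set (Fin d → ℤ)) (v : Fin d → ℤ) : ℕ :=
  if v = 0 then 0 else sInf {N : ℕ | 0 < N ∧ v ∈ nfold d A N}

/-- The set `S(A,B)` of `B`-minimal elements. -/
def Smin (d : ℕ) (A B : Set (Fin d → ℤ)) : Set (Fin d → ℤ) :=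
  {0} ∪ {u | u ∈ PA d A ∧ u ≠ 0 ∧
    ∀ f : Fin (NAfn d A u) → (Fin d → ℤ), (∀ i, f i ∈ A) → u = ∑ i, f i →
      ∀ i, f i ∉ B ∪ ({0} : Set (Fin d → ℤ))}

/-- The order simplex of antitone points of the unit cube has volume at least `1 / d!`. -/
lemma one_le_factorial_mul_volume_antitone (d : ℕ) :
    1 ≤ (d.factorial : ENNReal) *
      volume {x : Fin d → ℝ | (∀ i, 0 ≤ x i ∧ x i ≤ 1) ∧ Antitone x} := by
  set O : Set (Fin d → ℝ) := {x | (∀ i, 0 ≤ x i ∧ x i ≤ 1) ∧ Antitone x}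
  let e : Equiv.Perm (Fin d) → (Fin d → ℝ) ≃ᵐ (Fin d → ℝ) := fun σ =>
    MeasurableEquiv.piCongrLeft (fun _ => ℝ) σ
  have he : ∀ σ x i, e σ x (σ i) = x i := fun σ x i =>
    Equiv.piCongrLeft_apply_apply (fun _ => ℝ) σ x i
  have hcover : Set.Icc (0 : Fin d → ℝ) 1 ⊆ ⋃ σ : Equiv.Perm (Fin d), e σ ⁻¹' O := by
    intro x hx
    have hmono := Tuple.monotone_sort (fun i => -x i)
    set τ := Tuple.sort (fun i => -x i)
    have hval : ∀ i, e τ⁻¹ x i = x (τ i) := by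
      intro i
      have := he τ⁻¹ x (τ i)
      simpa using this
    refine Set.mem_iUnion.2 ⟨τ⁻¹, fun i => ?_, fun i j hij => ?_⟩
    · rw [hval]
      exact ⟨hx.1 _, hx.2 _⟩
    · rw [hval, hval]
      have := hmono hij
      simp only [Function.comp_apply] at this
      linarith
  calc (1 : ENNReal) = volume (Set.Icc (0 : Fin d → ℝ) 1) := by
        simp [Real.volume_Icc_pi]
    _ ≤ volume (⋃ σ : Equiv.Perm (Fin d), e σ ⁻¹' O) := measure_mono hcover
    _ ≤ ∑ σ : Equiv.Perm (Fin d), volume (e σ ⁻¹' O) := measure_iUnion_fintype_le _ _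
    _ = ∑ σ : Equiv.Perm (Fin d), volume O := by
        refine Finset.sum_congr rfl fun σ _ => ?_
        exact (volume_measurePreserving_piCongrLeft (fun _ => ℝ) σ).measure_preimage_equiv O
    _ = _ := by
        simp [Fintype.card_perm]

/-- A family of integer vectors that is pairwise incongruent modulo the column lattice of a
nonsingular integer matrix has at most `|det M|` members. -/
lemma card_le_natAbs_det {d : ℕ} {ι : Type*} [Fintype ι] (M : Matrix (Fin d) (Fin d) ℤ)
    (hM : M.det ≠ 0) (g : ι → Fin d → ℤ)
    (hg : ∀ i j, (∃ n, g i - g j = M.mulVec n) → i = j) :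
    Fintype.card ι ≤ M.det.natAbs := by
  have hinj : Function.Injective M.mulVecLin := by
    rw [← LinearMap.ker_eq_bot, LinearMap.ker_eq_bot']
    exact fun v hv => Matrix.eq_zero_of_mulVec_eq_zero hM hv
  let N : Submodule ℤ (Fin d → ℤ) := LinearMap.range M.mulVecLin
  let e : (Fin d → ℤ) ≃ₗ[ℤ] N := LinearEquiv.ofInjective M.mulVecLin hinj
  let bN : Module.Basis (Fin d) ℤ N := (Pi.basisFun ℤ (Fin d)).map e
  have hcard := Submodule.natAbs_det_basis_change (Pi.basisFun ℤ (Fin d)) N bN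
  have hdet : (Pi.basisFun ℤ (Fin d)).det ((↑) ∘ bN) = M.det := by
    rw [Pi.basisFun_det_apply, ← Matrix.det_transpose]
    congr 1
    ext i j
    have h : ((e (Pi.single j 1) : N) : Fin d → ℤ) = M.mulVecLin (Pi.single j 1) := rfl
    simp [bN, Matrix.of_apply, h]
  rw [hdet] at hcard
  have hfin : Finite ((Fin d → ℤ) ⧸ N) := by
    apply Nat.finite_of_card_ne_zero
    rw [← hcard]
    exact Int.natAbs_ne_zero.2 hM
  rw [hcard, ← Nat.card_eq_fintype_card]
  refine Nat.card_le_card_of_injective (fun i => (Submodule.Quotient.mk (g i) : _ ⧸ N)) ?_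
  intro i j hij
  rw [Submodule.Quotient.eq] at hij
  obtain ⟨n, hn⟩ := hij
  exact hg i j ⟨n, hn.symm⟩

/-- Summation by parts: a point given in the consecutive differences of a finite sequence is a
combination of its terms. -/
lemma sum_castSucc_sub_succ_smul {E : Type*} [AddCommGroup E] [Module ℝ E] {d : ℕ}
    (x : Fin d → ℝ) (y : Fin (d + 2) → ℝ) (P : Fin (d + 1) → E) (h0 : y 0 = 1)
    (hl : y (Fin.last _) = 0) (hx : ∀ j : Fin d, y j.succ.castSucc = x j) :
    ∑ k : Fin (d + 1), (y k.castSucc - y k.succ) • P k =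
      P 0 + ∑ j : Fin d, x j • (P j.succ - P j.castSucc) := by
  simp only [sub_smul, smul_sub, Finset.sum_sub_distrib]
  rw [Fin.sum_univ_succ, Fin.sum_univ_castSucc (fun k => y k.succ • P k)]
  simp only [hx, Fin.castSucc_zero, h0, Fin.succ_last, hl, zero_smul, one_smul, add_zero]
  have : ∀ j : Fin d, y j.castSucc.succ = x j := fun j => by rw [← hx j, Fin.succ_castSucc]
  simp only [this]
  abel

lemma add_sum_smul_sub_mem_convexHull {E : Type*} [AddCommGroup E] [Module ℝ E] {d : ℕ}
    (x : Fin d → ℝ) (hx : ∀ i, 0 ≤ x i ∧ x i ≤ 1) (hanti : Antitone x) (P : Fin (d + 1) → E) :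
    P 0 + ∑ j : Fin d, x j • (P j.succ - P j.castSucc) ∈ convexHull ℝ (Set.range P) := by
  let z : Fin (d + 1) → ℝ := Fin.snoc x 0
  let y : Fin (d + 2) → ℝ := Fin.cons 1 z
  have hzc : ∀ j : Fin d, z j.castSucc = x j := fun j => Fin.snoc_castSucc (α := fun _ => ℝ) _ _ _
  have hzl : z (Fin.last _) = 0 := Fin.snoc_last (α := fun _ => ℝ) _ _
  have hys : ∀ k, y k.succ = z k := fun k => Fin.cons_succ (α := fun _ => ℝ) _ _ _
  have h0 : y 0 = 1 := rfl
  have hl : y (Fin.last _) = 0 := by rw [← Fin.succ_last, hys, hzl]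
  have hy : ∀ j : Fin d, y j.succ.castSucc = x j := fun j => by
    rw [← Fin.succ_castSucc, hys, hzc]
  have hz1 : ∀ k, z k ≤ 1 := fun k => by
    induction k using Fin.lastCases with
    | last => rw [hzl]; exact zero_le_one
    | cast j => rw [hzc]; exact (hx j).2
  rw [← sum_castSucc_sub_succ_smul x y P h0 hl hy]
  refine (convex_convexHull ℝ _).sum_mem (fun k _ => sub_nonneg.2 ?_) ?_
    (fun k _ => subset_convexHull ℝ _ ⟨k, rfl⟩)
  · induction k using Fin.cases with
    | zero => rw [hys, Fin.castSucc_zero, h0]; exact hz1 0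
    | succ j =>
      rw [hy, hys]
      obtain h | ⟨i, hi⟩ := Fin.eq_castSucc_or_eq_last j.succ |>.symm
      · rw [h, hzl]; exact (hx j).1
      · rw [hi, hzc]
        refine hanti ?_
        have := congrArg Fin.val hi
        simp only [Fin.val_succ, Fin.val_castSucc] at this
        rw [Fin.le_def]
        omega
  · have := sum_castSucc_sub_succ_smul x y (fun _ => (1 : ℝ)) h0 hl hy
    simpa using this

/-- The integer matrix whose columns are the consecutive differences of `p`. -/
def stepMatrix {d : ℕ} (p : Fin (d + 1) → Fin d → ℤ) : Matrix (Fin d) (Fin d) ℤ :=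
  Matrix.of fun i j => p j.succ i - p j.castSucc i

lemma stepMatrix_map_mulVec {d : ℕ} (p : Fin (d + 1) → Fin d → ℤ) (x : Fin d → ℝ) :
    ((stepMatrix p).map (Int.castRingHom ℝ)).mulVec x =
      ∑ j : Fin d, x j • (emb d (p j.succ) - emb d (p j.castSucc)) := by
  ext i
  simp [Matrix.mulVec, dotProduct, stepMatrix, emb, Finset.sum_apply, mul_comm]

lemma stepMatrix_det_ne_zero {d : ℕ} (P : AffineBasis (Fin (d + 1)) ℝ (Fin d → ℝ))
    (p : Fin (d + 1) → Fin d → ℤ) (hp : ∀ k, P k = emb d (p k)) :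
    (stepMatrix p).det ≠ 0 := by
  set L := Matrix.mulVecLin ((stepMatrix p).map (Int.castRingHom ℝ)) with hL
  have hLx : ∀ x, L x = ∑ j : Fin d, x j • (P j.succ - P j.castSucc) := fun x => by
    simp only [hp]
    exact stepMatrix_map_mulVec p x
  have hmem : ∀ k, P k - P 0 ∈ LinearMap.range L := fun k => by
    induction k using Fin.induction with
    | zero => simp
    | succ j ih =>
      have : P j.succ - P 0 = (P j.succ - P j.castSucc) + (P j.castSucc - P 0) := by abel
      rw [this]
      refine add_mem ⟨Pi.single j 1, ?_⟩ ih
      rw [hLx, Finset.sum_eq_single j] <;> simp +contextual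
  have hsurj : LinearMap.range L = ⊤ := by
    rw [eq_top_iff, ← AffineSubspace.direction_top ℝ (Fin d → ℝ) (Fin d → ℝ), ← P.tot,
      direction_affineSpan, vectorSpan_range_eq_span_range_vsub_right ℝ P 0, Submodule.span_le]
    rintro _ ⟨k, rfl⟩
    exact hmem k
  have hdet : LinearMap.det L ≠ 0 := by
    have : IsUnit L := (Module.End.isUnit_iff _).2
      ⟨LinearMap.ker_eq_bot.1 (LinearMap.ker_eq_bot_iff_range_eq_top.2 hsurj),
        LinearMap.range_eq_top.1 hsurj⟩
    exact (LinearMap.isUnit_det L this).ne_zero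
  rw [hL, ← Matrix.toLin'_apply', LinearMap.det_toLin'] at hdet
  intro h
  apply hdet
  rw [← RingHom.mapMatrix_apply, ← RingHom.map_det, h, map_zero]

lemma natAbs_det_stepMatrix_le {d : ℕ} (p : Fin (d + 1) → Fin d → ℤ) :
    ((stepMatrix p).det.natAbs : ENNReal) ≤
      d.factorial * volume (convexHull ℝ (Set.range fun k => emb d (p k))) := by
  set L := Matrix.mulVecLin ((stepMatrix p).map (Int.castRingHom ℝ)) with hL
  set H := convexHull ℝ (Set.range fun k => emb d (p k))
  set O : Set (Fin d → ℝ) := {x | (∀ i, 0 ≤ x i ∧ x i ≤ 1) ∧ Antitone x}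
  have hdet : LinearMap.det L = ((stepMatrix p).det : ℝ) := by
    rw [hL, ← Matrix.toLin'_apply', LinearMap.det_toLin', ← RingHom.mapMatrix_apply,
      ← RingHom.map_det]
    rfl
  have hsub : L '' O ⊆ (fun x => emb d (p 0) + x) ⁻¹' H := by
    rintro _ ⟨x, hx, rfl⟩
    have := add_sum_smul_sub_mem_convexHull x hx.1 hx.2 fun k => emb d (p k)
    rw [← stepMatrix_map_mulVec] at this
    exact this
  have hvol : ENNReal.ofReal |LinearMap.det L| * volume O ≤ volume H := by
    rw [← Measure.addHaar_image_linearMap, ← measure_preimage_add volume (emb d (p 0)) H]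
    exact measure_mono hsub
  have habs : ENNReal.ofReal |LinearMap.det L| = ((stepMatrix p).det.natAbs : ENNReal) := by
    rw [hdet, ← Int.cast_abs, Int.abs_eq_natAbs, Int.cast_natCast, ENNReal.ofReal_natCast]
  rw [habs] at hvol
  calc ((stepMatrix p).det.natAbs : ENNReal)
      ≤ (stepMatrix p).det.natAbs * (d.factorial * volume O) :=
        le_mul_of_one_le_right zero_le (one_le_factorial_mul_volume_antitone d)
    _ = d.factorial * ((stepMatrix p).det.natAbs * volume O) := by ring
    _ ≤ _ := by gcongr

/-- Integer vectors whose barycentric coordinates are pairwise incongruent modulo `ℤ` number at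
most `d!` times the volume of the simplex. -/
lemma card_le_factorial_mul_volume {d : ℕ} (P : AffineBasis (Fin (d + 1)) ℝ (Fin d → ℝ))
    (p : Fin (d + 1) → Fin d → ℤ) (hp : ∀ k, P k = emb d (p k))
    {ι : Type*} [Fintype ι] (g : ι → Fin d → ℤ)
    (hg : ∀ i j, (∀ k, ∃ n : ℤ, P.coord k (emb d (g i)) - P.coord k (emb d (g j)) = n) → i = j) :
    (Fintype.card ι : ℝ) ≤ d.factorial * (volume (convexHull ℝ (Set.range P))).toReal := by
  have hcard := card_le_natAbs_det (stepMatrix p) (stepMatrix_det_ne_zero P p hp) g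
    (fun i j ⟨n, hn⟩ => hg i j fun k => by
      refine ⟨∑ l, n l * ((if k = l.succ then 1 else 0) - if k = l.castSucc then 1 else 0), ?_⟩
      have hreal : emb d (g i) - emb d (g j) =
          ∑ l : Fin d, (n l : ℝ) • (P l.succ - P l.castSucc) := by
        simp only [hp]
        rw [← stepMatrix_map_mulVec p fun l => (n l : ℝ)]
        ext a
        have := congrArg (fun z : ℤ => (z : ℝ)) (congrFun hn a)
        simpa [emb, Matrix.mulVec, dotProduct] using this
      rw [← vsub_eq_sub, ← AffineMap.linearMap_vsub, vsub_eq_sub, hreal, map_sum]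
      push_cast
      refine Finset.sum_congr rfl fun l _ => ?_
      rw [map_smul, ← vsub_eq_sub, AffineMap.linearMap_vsub, P.coord_apply, P.coord_apply]
      simp)
  have hvol := natAbs_det_stepMatrix_le p
  have hPp : (P : Fin (d + 1) → Fin d → ℝ) = fun k => emb d (p k) := funext hp
  rw [← hPp] at hvol
  have hfin : volume (convexHull ℝ (Set.range P)) ≠ ⊤ :=
    ((isBounded_convexHull.2 (Set.finite_range P).isBounded).measure_lt_top).ne
  have := ENNReal.toReal_mono (ENNReal.mul_ne_top (ENNReal.natCast_ne_top _) hfin) hvol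
  rw [ENNReal.toReal_mul, ENNReal.toReal_natCast, ENNReal.toReal_natCast] at this
  exact le_trans (by exact_mod_cast hcard) this

lemma emb_add {d : ℕ} (x y : Fin d → ℤ) : emb d (x + y) = emb d x + emb d y := by
  ext i; simp [emb]

lemma emb_sub {d : ℕ} (x y : Fin d → ℤ) : emb d (x - y) = emb d x - emb d y := by
  ext i; simp [emb]

lemma emb_nsmul {d : ℕ} (n : ℕ) (x : Fin d → ℤ) : emb d (n • x) = (n : ℝ) • emb d x := by
  ext i; simp [emb]

lemma emb_injective (d : ℕ) : Function.Injective (emb d) := fun x y h => by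
  ext i
  exact Int.cast_injective (congrFun h i)

lemma mem_nfold_iff {d : ℕ} {A : Set (Fin d → ℤ)} {N : ℕ} {x : Fin d → ℤ} :
    x ∈ nfold d A N ↔ ∃ S : Multiset (Fin d → ℤ), (∀ a ∈ S, a ∈ A) ∧ S.card = N ∧ S.sum = x := by
  constructor
  · rintro ⟨f, hf, rfl⟩
    refine ⟨Finset.univ.val.map f, fun a ha => ?_, by simp, rfl⟩
    obtain ⟨i, _, rfl⟩ := Multiset.mem_map.1 ha
    exact hf i
  · rintro ⟨S, hS, rfl, rfl⟩
    induction S using Quotient.inductionOn with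
    | h l =>
      refine ⟨fun i => l.get i, fun i => hS _ (List.get_mem l i), ?_⟩
      simp only [Multiset.quot_mk_to_coe, Multiset.sum_coe]
      exact (Fin.sum_univ_getElem l).symm

/-- The homogeneous barycentric coordinates of the lattice point `u.1` at height `u.2`. -/
def homCoord {d : ℕ} (P : AffineBasis (Fin (d + 1)) ℝ (Fin d → ℝ)) :
    (Fin d → ℤ) × ℤ →+ (Fin (d + 1) → ℝ) :=
  AddMonoidHom.mk' (fun u k => (P.coord k).linear (emb d u.1) + u.2 * P.coord k 0) fun u v => by
    ext k
    simp only [Prod.fst_add, Prod.snd_add, emb_add, map_add, Int.cast_add, Pi.add_apply]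
    ring

section HomCoord

variable {d : ℕ} (P : AffineBasis (Fin (d + 1)) ℝ (Fin d → ℝ))

lemma homCoord_apply (u : (Fin d → ℤ) × ℤ) (k : Fin (d + 1)) :
    homCoord P u k = (P.coord k).linear (emb d u.1) + u.2 * P.coord k 0 := rfl

lemma coord_eq_linear_add (y : Fin d → ℝ) (k : Fin (d + 1)) :
    P.coord k y = (P.coord k).linear y + P.coord k 0 := by
  have := (P.coord k).linearMap_vsub y 0
  simp only [vsub_eq_sub, sub_zero] at this
  rw [this]
  ring

lemma homCoord_one (a : Fin d → ℤ) (k : Fin (d + 1)) :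
    homCoord P (a, 1) k = P.coord k (emb d a) := by
  rw [homCoord_apply, coord_eq_linear_add P (emb d a)]
  simp

lemma sum_homCoord (u : (Fin d → ℤ) × ℤ) : ∑ k, homCoord P u k = u.2 := by
  have h0 := P.sum_coord_apply_eq_one (0 : Fin d → ℝ)
  have h1 := P.sum_coord_apply_eq_one (emb d u.1)
  simp only [coord_eq_linear_add P (emb d u.1), Finset.sum_add_distrib, h0] at h1
  simp only [homCoord_apply, Finset.sum_add_distrib, ← Finset.mul_sum, h0]
  linarith

lemma homCoord_injective : Function.Injective (homCoord P) := by
  rw [injective_iff_map_eq_zero]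
  rintro ⟨x, h⟩ hu
  have hh : (h : ℝ) = 0 := by
    have := sum_homCoord P (x, h)
    simpa [hu] using this.symm
  have hh' : h = 0 := by exact_mod_cast hh
  have hx : emb d x = 0 := P.ext_elem fun k => by
    have := congrFun hu k
    rw [homCoord_apply] at this
    simp only [hh, zero_mul, add_zero, Pi.zero_apply] at this
    rw [coord_eq_linear_add, this, zero_add]
  have hx' : x = 0 := by
    apply emb_injective
    rw [hx]
    ext i
    simp [emb]
  rw [hx', hh']
  rfl

lemma homCoord_smul (N : ℕ) (x : Fin d → ℤ) (y : Fin d → ℝ) (h : emb d x = (N : ℝ) • y)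
    (k : Fin (d + 1)) : homCoord P (x, (N : ℤ)) k = N * P.coord k y := by
  rw [homCoord_apply, coord_eq_linear_add P y, h, map_smul, smul_eq_mul]
  push_cast
  ring

/-- The sum of a multiset of lattice points, each placed at height one. -/
def liftSum (d : ℕ) : Multiset (Fin d → ℤ) →+ (Fin d → ℤ) × ℤ :=
  Multiset.sumAddMonoidHom.comp (Multiset.mapAddMonoidHom fun a => (a, 1))

lemma liftSum_singleton (a : Fin d → ℤ) : liftSum d {a} = (a, 1) := by
  simp [liftSum]

lemma liftSum_cons (a : Fin d → ℤ) (S : Multiset (Fin d → ℤ)) :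
    liftSum d (a ::ₘ S) = (a, 1) + liftSum d S := by
  simp [liftSum]

lemma liftSum_eq (S : Multiset (Fin d → ℤ)) : liftSum d S = (S.sum, (S.card : ℤ)) := by
  induction S using Multiset.induction_on with
  | empty => rfl
  | cons a S ih =>
    rw [liftSum_cons, ih]
    simp [add_comm]

variable {P}

lemma homCoord_liftSum_nonneg {S : Multiset (Fin d → ℤ)} {k : Fin (d + 1)}
    (hS : ∀ a ∈ S, 0 ≤ P.coord k (emb d a)) : 0 ≤ homCoord P (liftSum d S) k := by
  induction S using Multiset.induction_on with
  | empty => simp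
  | cons a S ih =>
    rw [liftSum_cons, map_add, Pi.add_apply, homCoord_one]
    exact add_nonneg (hS a (Multiset.mem_cons_self a S))
      (ih fun b hb => hS b (Multiset.mem_cons_of_mem hb))

lemma homCoord_liftSum_le_card {S : Multiset (Fin d → ℤ)} {k : Fin (d + 1)}
    (hS : ∀ a ∈ S, P.coord k (emb d a) ≤ 1) : homCoord P (liftSum d S) k ≤ S.card := by
  induction S using Multiset.induction_on with
  | empty => simp
  | cons a S ih =>
    rw [liftSum_cons, map_add, Pi.add_apply, homCoord_one, Multiset.card_cons]
    push_cast
    linarith [hS a (Multiset.mem_cons_self a S),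
      ih fun b hb => hS b (Multiset.mem_cons_of_mem hb)]

variable {p : Fin (d + 1) → Fin d → ℤ}

lemma homCoord_vertex (hp : ∀ k, P k = emb d (p k)) (j k : Fin (d + 1)) :
    homCoord P (p j, 1) k = ((if k = j then 1 else 0 : ℕ) : ℝ) := by
  rw [homCoord_one, ← hp, P.coord_apply]
  simp

lemma exists_nat_homCoord_liftSum (hp : ∀ k, P k = emb d (p k))
    {S : Multiset (Fin d → ℤ)} (hS : ∀ a ∈ S, a ∈ Set.range p) (k : Fin (d + 1)) :
    ∃ n : ℕ, homCoord P (liftSum d S) k = n := by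
  induction S using Multiset.induction_on with
  | empty => exact ⟨0, by simp⟩
  | cons a S ih =>
    obtain ⟨n, hn⟩ := ih fun b hb => hS b (Multiset.mem_cons_of_mem hb)
    obtain ⟨j, rfl⟩ := hS a (Multiset.mem_cons_self a S)
    refine ⟨(if k = j then 1 else 0) + n, ?_⟩
    rw [liftSum_cons, map_add, Pi.add_apply, hn, homCoord_vertex hp]
    push_cast
    rfl

/-- Lattice points at arbitrary heights that are pairwise incongruent modulo the lattice generated
by the lifted vertices number at most `d!` times the volume of the simplex. -/
lemma card_le_of_homCoord_incongruent (hp : ∀ k, P k = emb d (p k))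
    {ι : Type*} [Fintype ι] (u : ι → (Fin d → ℤ) × ℤ)
    (hu : ∀ i j, (∀ k, ∃ n : ℤ, homCoord P (u i) k - homCoord P (u j) k = n) → i = j) :
    (Fintype.card ι : ℝ) ≤ d.factorial * (volume (convexHull ℝ (Set.range P))).toReal := by
  have key : ∀ (i : ι) (k : Fin (d + 1)),
      P.coord k (emb d ((u i).1 - ((u i).2 - 1) • p 0)) =
        homCoord P (u i) k - ((((u i).2 - 1) * if k = 0 then 1 else 0 : ℤ) : ℝ) := by
    intro i k
    have h : (((u i).1 - ((u i).2 - 1) • p 0, 1) : (Fin d → ℤ) × ℤ) =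
        u i - ((u i).2 - 1) • (p 0, 1) := by
      ext <;> simp
    rw [← homCoord_one, h, map_sub, map_zsmul, Pi.sub_apply, Pi.smul_apply, homCoord_vertex hp]
    simp
  refine card_le_factorial_mul_volume P p hp (fun i => (u i).1 - ((u i).2 - 1) • p 0) ?_
  intro i j hij
  refine hu i j fun k => ?_
  obtain ⟨n, hn⟩ := hij k
  rw [key, key] at hn
  exact ⟨n + ((u i).2 - 1) * (if k = 0 then 1 else 0) - ((u j).2 - 1) * (if k = 0 then 1 else 0),
    by push_cast at hn ⊢; linarith⟩

end HomCoord

section Reduction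

variable {d : ℕ} (P : AffineBasis (Fin (d + 1)) ℝ (Fin d → ℝ))

/-- Congruence of homogeneous barycentric coordinates modulo `ℤ`. -/
def HomCongr (u v : (Fin d → ℤ) × ℤ) : Prop :=
  ∀ k, ∃ n : ℤ, homCoord P u k - homCoord P v k = n

variable {P}

lemma HomCongr.symm {u v : (Fin d → ℤ) × ℤ} (h : HomCongr P u v) : HomCongr P v u := fun k => by
  obtain ⟨n, hn⟩ := h k
  exact ⟨-n, by push_cast; linarith⟩

variable (P)

/-- No sub-multiset of `S` can be traded for a smaller multiset with at most one element, taken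
from `F`, without changing its class. -/
def IsExchangeReduced (F : Finset (Fin d → ℤ)) (S : Multiset (Fin d → ℤ)) : Prop :=
  ∀ T ≤ S, ∀ U : Multiset (Fin d → ℤ), (∀ a ∈ U, a ∈ F) → U.card ≤ 1 → U.card < T.card →
    ¬ HomCongr P (liftSum d T) (liftSum d U)

variable {P}

lemma homCoord_liftSum_lt_one {F : Finset (Fin d → ℤ)}
    (hF : ∀ a ∈ F, ∀ k, P.coord k (emb d a) < 1) {U : Multiset (Fin d → ℤ)}
    (hU : ∀ a ∈ U, a ∈ F) (hcard : U.card ≤ 1) (k : Fin (d + 1)) :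
    homCoord P (liftSum d U) k < 1 := by
  obtain h | h := Nat.le_one_iff_eq_zero_or_eq_one.1 hcard
  · rw [Multiset.card_eq_zero.1 h]
    simp
  · obtain ⟨a, rfl⟩ := Multiset.card_eq_one.1 h
    rw [liftSum_singleton, homCoord_one]
    exact hF a (hU a (Multiset.mem_singleton_self a)) k

lemma card_add_card_le_of_isExchangeReduced {p : Fin (d + 1) → Fin d → ℤ}
    (hp : ∀ k, P k = emb d (p k)) {F : Finset (Fin d → ℤ)} (hF0 : ∀ a ∈ F, ∀ k, 0 ≤ P.coord k (emb d a))
    (hF1 : ∀ a ∈ F, ∀ k, P.coord k (emb d a) < 1) {S : Multiset (Fin d → ℤ)}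
    (hred : IsExchangeReduced P F S) :
    ((F.card + 1 + (S.card - 1) : ℕ) : ℝ) ≤
      d.factorial * (volume (convexHull ℝ (Set.range P))).toReal := by
  let l := S.toList
  have hl : (l : Multiset (Fin d → ℤ)) = S := S.coe_toList
  have hlen : l.length = S.card := S.length_toList
  let U : Option F → Multiset (Fin d → ℤ) := fun o => o.elim 0 fun a => {a.1}
  have hUF : ∀ o, ∀ a ∈ U o, a ∈ F := by
    rintro (_ | a) b hb
    · exact absurd hb (Multiset.notMem_zero b)
    · rw [Multiset.mem_singleton.1 hb]
      exact a.2
  have hU1 : ∀ o, (U o).card ≤ 1 := by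
    rintro (_ | a) <;> simp [U]
  let u : Option F ⊕ Fin (S.card - 1) → (Fin d → ℤ) × ℤ :=
    Sum.elim (fun o => liftSum d (U o)) fun r => liftSum d (l.take (r + 2) : List _)
  have hmixed : ∀ (r : Fin (S.card - 1)) (o : Option F),
      ¬ HomCongr P (liftSum d (l.take (r + 2) : List _)) (liftSum d (U o)) := by
    intro r o
    refine hred _ ?_ _ (hUF o) (hU1 o) ?_
    · refine le_of_le_of_eq ?_ hl
      exact Multiset.coe_le.2 (List.take_sublist _ _).subperm
    · have := hU1 o
      have hr := r.2
      rw [Multiset.coe_card, List.length_take, hlen]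
      omega
  have hpartial : ∀ r s : Fin (S.card - 1), r < s →
      ¬ HomCongr P (liftSum d (l.take (s + 2) : List _)) (liftSum d (l.take (r + 2) : List _)) := by
    intro r s hrs h
    have hsplit : l.take (s + 2) = l.take (r + 2) ++ (l.take (s + 2)).drop (r + 2) := by
      have := List.take_append_drop (r + 2) (l.take (s + 2))
      rw [List.take_take, min_eq_left (by have : (r : ℕ) < s := hrs; omega)] at this
      exact this.symm
    refine hred ((l.take (s + 2)).drop (r + 2) : List _) ?_ 0 (by simp) (by simp) ?_ fun k => ?_
    · refine le_of_le_of_eq ?_ hl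
      exact Multiset.coe_le.2 ((List.drop_sublist _ _).trans (List.take_sublist _ _)).subperm
    · have hs := s.2
      have : (r : ℕ) < s := hrs
      rw [Multiset.coe_card, List.length_drop, List.length_take, hlen, Multiset.card_zero]
      omega
    · obtain ⟨n, hn⟩ := h k
      refine ⟨n, ?_⟩
      rw [hsplit, ← Multiset.coe_add, map_add, map_add, Pi.add_apply] at hn
      rw [map_zero, map_zero, Pi.zero_apply]
      linarith
  have hcard := card_le_of_homCoord_incongruent hp u (by
    rintro (o | r) (o' | r') h
    · have heq : liftSum d (U o) = liftSum d (U o') := by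
        apply homCoord_injective P
        ext k
        obtain ⟨n, hn⟩ := h k
        change homCoord P (liftSum d (U o)) k - homCoord P (liftSum d (U o')) k = n at hn
        have h1 := homCoord_liftSum_lt_one hF1 (hUF o) (hU1 o) k
        have h2 := homCoord_liftSum_lt_one hF1 (hUF o') (hU1 o') k
        have h3 := homCoord_liftSum_nonneg (k := k) fun a ha => hF0 a (hUF o a ha) k
        have h4 := homCoord_liftSum_nonneg (k := k) fun a ha => hF0 a (hUF o' a ha) k
        have h5 : n < 1 := by exact_mod_cast (show (n : ℝ) < 1 by linarith)
        have h6 : -1 < n := by exact_mod_cast (show (-1 : ℝ) < n by linarith)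
        have h7 : n = 0 := by omega
        rw [h7, Int.cast_zero] at hn
        linarith
      rw [liftSum_eq, liftSum_eq, Prod.mk.injEq] at heq
      rcases o with _ | a <;> rcases o' with _ | b
      · rfl
      · exact absurd heq.2 (by simp [U])
      · exact absurd heq.2 (by simp [U])
      · have := heq.1
        simp only [U, Option.elim, Multiset.sum_singleton] at this
        rw [Subtype.ext this]
    · exact absurd (HomCongr.symm h) (hmixed r' o)
    · exact absurd h (hmixed r o')
    · rcases lt_trichotomy r r' with hlt | rfl | hlt
      · exact absurd (HomCongr.symm h) (hpartial r r' hlt)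
      · rfl
      · exact absurd h (hpartial r' r hlt))
  simpa using hcard

/-- A representation of `u` by elements of `F` and integer multiples of the vertices, with
nonnegative multiplicities except possibly at the vertex `i`. -/
def IsRep (P : AffineBasis (Fin (d + 1)) ℝ (Fin d → ℝ)) (F : Finset (Fin d → ℤ))
    (i : Fin (d + 1)) (u : (Fin d → ℤ) × ℤ) (S : Multiset (Fin d → ℤ)) : Prop :=
  (∀ a ∈ S, a ∈ F) ∧ ∃ m : Fin (d + 1) → ℤ, (∀ k, k ≠ i → 0 ≤ m k) ∧
    ∀ k, homCoord P u k = homCoord P (liftSum d S) k + m k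

lemma IsRep.exists_isExchangeReduced {F : Finset (Fin d → ℤ)} {i : Fin (d + 1)}
    {u : (Fin d → ℤ) × ℤ} (hF0 : ∀ a ∈ F, ∀ k, 0 ≤ P.coord k (emb d a))
    (hF1 : ∀ a ∈ F, ∀ k, P.coord k (emb d a) < 1)
    {S₀ : Multiset (Fin d → ℤ)} (h : IsRep P F i u S₀) :
    ∃ S, IsRep P F i u S ∧ IsExchangeReduced P F S := by
  classical
  induction hn : S₀.card using Nat.strong_induction_on generalizing S₀ with
  | _ n ih =>
  by_cases hred : IsExchangeReduced P F S₀
  · exact ⟨S₀, h, hred⟩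
  · unfold IsExchangeReduced at hred
    push Not at hred
    obtain ⟨T, hTS, U, hUF, hU1, hUT, hcong⟩ := hred
    obtain ⟨hSF, m, hm, hrep⟩ := h
    choose n hnk using hcong
    have hsplit : liftSum d S₀ = liftSum d (S₀ - T) + liftSum d T := by
      rw [← map_add, tsub_add_cancel_of_le hTS]
    refine ih (S₀ - T + U).card ?_ (S₀ := S₀ - T + U) ⟨fun a ha => ?_, m + n, fun k hk => ?_,
      fun k => ?_⟩ rfl
    · have := Multiset.card_le_card hTS
      rw [Multiset.card_add, Multiset.card_sub hTS]
      omega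
    · obtain ha | ha := Multiset.mem_add.1 ha
      · exact hSF a (Multiset.mem_of_le (Multiset.sub_le_self S₀ T) ha)
      · exact hUF a ha
    · have h1 := homCoord_liftSum_lt_one hF1 hUF hU1 k
      have h2 := homCoord_liftSum_nonneg (k := k) fun a ha =>
        hF0 a (hSF a (Multiset.mem_of_le hTS ha)) k
      have h3 : -1 < n k := by
        have := hnk k
        exact_mod_cast (show (-1 : ℝ) < n k by linarith)
      have := hm k hk
      simp only [Pi.add_apply]
      omega
    · have h1 := hrep k
      have h2 := hnk k
      rw [hsplit, map_add, Pi.add_apply] at h1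
      rw [map_add, map_add, Pi.add_apply, Pi.add_apply]
      push_cast
      linarith

/-- Nonnegative integer coordinates beyond a multiset `S` exhibit `x` as a sum of `N` terms. -/
lemma mem_nfold_of_homCoord {p : Fin (d + 1) → Fin d → ℤ} (hp : ∀ k, P k = emb d (p k))
    {A : Set (Fin d → ℤ)} (hpA : ∀ k, p k ∈ A) {S : Multiset (Fin d → ℤ)} (hS : ∀ a ∈ S, a ∈ A)
    {N : ℕ} {x : Fin d → ℤ} (m : Fin (d + 1) → ℤ) (hm : ∀ k, 0 ≤ m k)
    (h : ∀ k, homCoord P (x, (N : ℤ)) k = homCoord P (liftSum d S) k + m k) :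
    x ∈ nfold d A N := by
  let R : Multiset (Fin d → ℤ) := ∑ j, (m j).toNat • {p j}
  have hR : ∀ k, homCoord P (liftSum d R) k = m k := by
    intro k
    simp only [R, map_sum, map_nsmul, liftSum_singleton, Finset.sum_apply, Pi.smul_apply,
      homCoord_vertex hp]
    rw [Finset.sum_eq_single k (by intro b _ hb; simp [hb.symm]) (by simp)]
    simp only [if_true, Nat.cast_one, nsmul_eq_mul, mul_one]
    exact_mod_cast Int.toNat_of_nonneg (hm k)
  have heq : (x, (N : ℤ)) = liftSum d (S + R) := by
    apply homCoord_injective P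
    ext k
    rw [h, map_add, map_add, Pi.add_apply, hR]
  rw [liftSum_eq, Prod.mk.injEq] at heq
  refine mem_nfold_iff.2 ⟨S + R, fun a ha => ?_, by exact_mod_cast heq.2.symm, heq.1.symm⟩
  obtain ha | ha := Multiset.mem_add.1 ha
  · exact hS a ha
  · obtain ⟨j, _, hj⟩ := Multiset.mem_sum.1 ha
    rw [Multiset.mem_singleton.1 (Multiset.mem_of_mem_nsmul hj)]
    exact hpA j

end Reduction

lemma exists_affineBasis_of_isSimplex {d : ℕ} {A : Finset (Fin d → ℤ)} (h : IsSimplex d A) :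
    ∃ (P : AffineBasis (Fin (d + 1)) ℝ (Fin d → ℝ)) (p : Fin (d + 1) → Fin d → ℤ),
      (∀ k, P k = emb d (p k)) ∧ (∀ k, p k ∈ A) ∧ hull d A = convexHull ℝ (Set.range P) ∧
      Submodule.span ℝ
        (emb d '' ((A : Set (Fin d → ℤ)) - (A : Set (Fin d → ℤ)))) = ⊤ := by
  obtain ⟨B, hBA, hcard, hspan, hhull⟩ := h
  let e := (B.equivFinOfCardEq hcard).symm
  let p : Fin (d + 1) → Fin d → ℤ := fun k => (e k).1
  have hrange : Set.range (fun k => emb d (p k)) = emb d '' (B : Set (Fin d → ℤ)) := by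
    ext y
    constructor
    · rintro ⟨k, rfl⟩
      exact ⟨p k, (e k).2, rfl⟩
    · rintro ⟨b, hb, rfl⟩
      exact ⟨e.symm ⟨b, hb⟩, by simp [p]⟩
  have hvec : vectorSpan ℝ (Set.range fun k => emb d (p k)) = ⊤ := by
    rw [vectorSpan_def, hrange, ← hspan]
    congr 1
    ext y
    constructor
    · rintro ⟨_, ⟨a, ha, rfl⟩, _, ⟨b, hb, rfl⟩, rfl⟩
      exact ⟨a - b, ⟨a, ha, b, hb, rfl⟩, emb_sub a b⟩
    · rintro ⟨_, ⟨a, ha, b, hb, rfl⟩, rfl⟩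
      exact ⟨_, ⟨a, ha, rfl⟩, _, ⟨b, hb, rfl⟩, (emb_sub a b).symm⟩
  have hind : AffineIndependent ℝ fun k => emb d (p k) := by
    rw [affineIndependent_iff_finrank_vectorSpan_eq ℝ _ (Fintype.card_fin (d + 1)), hvec]
    simp
  have htot : affineSpan ℝ (Set.range fun k => emb d (p k)) = ⊤ :=
    (AffineSubspace.affineSpan_eq_top_iff_vectorSpan_eq_top_of_nonempty _ _ _
      (Set.range_nonempty _)).2 hvec
  refine ⟨⟨fun k => emb d (p k), hind, htot⟩, p, fun k => rfl, fun k => hBA (e k).2, ?_, ?_⟩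
  · rw [← hhull]
    exact congrArg (convexHull ℝ) hrange.symm
  · rw [eq_top_iff, ← hspan]
    exact Submodule.span_mono (Set.image_mono (Set.sub_subset_sub hBA hBA))

section Simplex

variable {d : ℕ} {P : AffineBasis (Fin (d + 1)) ℝ (Fin d → ℝ)}

lemma coord_le_one_of_nonneg {y : Fin d → ℝ} (hy : ∀ k, 0 ≤ P.coord k y) (k : Fin (d + 1)) :
    P.coord k y ≤ 1 := by
  rw [← P.sum_coord_apply_eq_one y]
  exact Finset.single_le_sum (f := fun k => P.coord k y) (fun k _ => hy k) (Finset.mem_univ k)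

lemma coord_lt_one_of_ne {y : Fin d → ℝ} (hy : ∀ k, 0 ≤ P.coord k y) {k : Fin (d + 1)}
    (hne : y ≠ P k) : P.coord k y < 1 := by
  refine lt_of_le_of_ne (coord_le_one_of_nonneg hy k) fun h1 => hne (P.ext_elem fun j => ?_)
  rw [P.coord_apply]
  by_cases hj : j = k
  · rw [if_pos hj, hj, h1]
  · rw [if_neg hj]
    refine le_antisymm ?_ (hy j)
    have := P.sum_coord_apply_eq_one y
    have hle := Finset.add_le_sum (f := fun k => P.coord k y) (fun k _ => hy k)
      (Finset.mem_univ j) (Finset.mem_univ k) hj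
    linarith

lemma vertex_mem_exP (hd : 1 ≤ d) {A : Finset (Fin d → ℤ)}
    (hhull : hull d A = convexHull ℝ (Set.range P))
    (hspan : Submodule.span ℝ
      (emb d '' ((A : Set (Fin d → ℤ)) - (A : Set (Fin d → ℤ)))) = ⊤)
    {p : Fin (d + 1) → Fin d → ℤ} (hp : ∀ k, P k = emb d (p k)) (i : Fin (d + 1)) :
    p i ∈ exP d A := by
  set ℓ := (P.coord i).linear with hℓ
  have hdot : ∀ y : Fin d → ℝ, ∑ j, -ℓ (Pi.single j 1) * y j = -ℓ y := by
    intro y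
    conv_rhs => rw [LinearMap.pi_apply_eq_sum_univ ℓ y]
    rw [← Finset.sum_neg_distrib]
    refine Finset.sum_congr rfl fun j _ => ?_
    have : (fun k => if j = k then (1 : ℝ) else 0) = Pi.single j 1 := by
      ext k
      simp [Pi.single_apply, eq_comm]
    rw [this, smul_eq_mul]
    ring
  refine ⟨?_, fun j => -ℓ (Pi.single j 1), hspan ▸ Submodule.mem_top, fun h0 => ?_,
    fun y hy hne => ?_⟩
  · rw [hhull, ← hp]
    exact subset_convexHull ℝ _ ⟨i, rfl⟩
  · have : Nontrivial (Fin (d + 1)) := Fin.nontrivial_iff_two_le.2 (by omega)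
    obtain ⟨j, hj⟩ := exists_ne i
    have hzero : ∀ y, ℓ y = 0 := fun y => by
      have := hdot y
      simp only [fun j => congrFun h0 j, Pi.zero_apply, zero_mul, Finset.sum_const_zero] at this
      linarith
    have h1 := coord_eq_linear_add P (P i) i
    have h2 := coord_eq_linear_add P (P j) i
    rw [← hℓ, hzero, P.coord_apply_eq] at h1
    rw [← hℓ, hzero, P.coord_apply_ne hj.symm] at h2
    linarith
  · rw [hdot, hdot]
    rw [hhull, P.convexHull_eq_nonneg_coord] at hy
    have h1 := coord_lt_one_of_ne hy (hp i ▸ hne)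
    have h2 := coord_eq_linear_add P (P i) i
    rw [P.coord_apply_eq, hp] at h2
    rw [coord_eq_linear_add] at h1
    linarith

lemma smul_vertex_sub_mem_cone {A : Finset (Fin d → ℤ)} {p : Fin (d + 1) → Fin d → ℤ}
    (hp : ∀ k, P k = emb d (p k)) (hpA : ∀ k, p k ∈ A) {N : ℕ} {x : Fin d → ℤ} {y : Fin d → ℝ}
    (hx : emb d x = (N : ℝ) • y) (hy : ∀ k, 0 ≤ P.coord k y) (b : Fin d → ℤ) :
    emb d (N • b - x) ∈ cone d (A.image fun a => b - a) := by
  refine ⟨fun v => ∑ k, if v = b - p k then N * P.coord k y else 0, fun v => ?_, ?_⟩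
  · refine Finset.sum_nonneg fun k _ => ?_
    split_ifs
    · exact mul_nonneg (Nat.cast_nonneg N) (hy k)
    · exact le_rfl
  · simp only [Finset.sum_smul, ite_smul, zero_smul]
    rw [Finset.sum_comm]
    have : ∀ k, (∑ v ∈ A.image fun a => b - a,
        if v = b - p k then (N * P.coord k y) • emb d v else 0) =
          (N : ℝ) • (P.coord k y • emb d b - P.coord k y • P k) := fun k => by
      rw [Finset.sum_ite_eq_of_mem' _ _ _ (Finset.mem_image_of_mem _ (hpA k)), emb_sub, hp,
        mul_smul, smul_sub]
    simp only [this]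
    rw [← Finset.smul_sum, Finset.sum_sub_distrib, ← Finset.sum_smul, P.sum_coord_apply_eq_one,
      P.linear_combination_coord_eq_self, one_smul, emb_sub, hx, emb_nsmul, smul_sub]

end Simplex

lemma nsmul_vertex_sub_mem_latt {d : ℕ} {A : Finset (Fin d → ℤ)} {a₀ b : Fin d → ℤ}
    (ha₀ : a₀ ∈ A) {N : ℕ} {z : Fin d → ℤ}
    (hz : z ∈ latt d ((A : Set (Fin d → ℤ)) - (A : Set (Fin d → ℤ)))) :
    N • b - (N • a₀ + z) ∈ latt d ↑(A.image fun a => b - a) := by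
  have hgen : ∀ a ∈ A, b - a ∈ latt d ↑(A.image fun a => b - a) := fun a ha =>
    AddSubgroup.subset_closure (Finset.mem_coe.2 (Finset.mem_image_of_mem _ ha))
  have hle : latt d ((A : Set (Fin d → ℤ)) - (A : Set (Fin d → ℤ))) ≤
      latt d ↑(A.image fun a => b - a) := by
    refine (AddSubgroup.closure_le _).2 ?_
    rintro _ ⟨a, ha, a', ha', rfl⟩
    have := sub_mem (hgen a' ha') (hgen a ha)
    rwa [sub_sub_sub_cancel_left] at this
  have : N • b - (N • a₀ + z) = N • (b - a₀) - z := by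
    rw [smul_sub]
    abel
  rw [this]
  exact sub_mem (nsmul_mem (hgen a₀ ha₀) N) (hle hz)

lemma nfold_subset {d : ℕ} {A : Finset (Fin d → ℤ)} {a₀ : Fin d → ℤ} (ha₀ : a₀ ∈ A) {N : ℕ}
    (hN : 1 ≤ N) :
    emb d '' nfold d ↑A N ⊆
      ((N : ℝ) • hull d A ∩
        emb d '' (({N • a₀} : Set (Fin d → ℤ)) +
          (latt d ((A : Set (Fin d → ℤ)) - (A : Set (Fin d → ℤ))) : Set (Fin d → ℤ)))) \
      ⋃ a ∈ exP d A,
        emb d '' (({N • a} : Set (Fin d → ℤ)) - excep d (A.image fun y => a - y)) := by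
  rintro _ ⟨_, ⟨f, hf, rfl⟩, rfl⟩
  have hN0 : (N : ℝ) ≠ 0 := by exact_mod_cast (show N ≠ 0 by omega)
  refine ⟨⟨⟨∑ i, (N : ℝ)⁻¹ • emb d (f i), ?_, ?_⟩,
    ∑ i, f i, ⟨N • a₀, rfl, ∑ i, (f i - a₀), ?_, ?_⟩, rfl⟩, fun hmem => ?_⟩
  · exact (convex_convexHull ℝ _).sum_mem (fun _ _ => by positivity) (by simp [hN0])
      fun i _ => subset_convexHull ℝ _ ⟨f i, hf i, rfl⟩
  · simp only
    rw [← Finset.smul_sum, smul_inv_smul₀ hN0]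
    ext j
    simp [emb]
  · exact sum_mem fun i _ => AddSubgroup.subset_closure ⟨f i, hf i, a₀, ha₀, rfl⟩
  · simp
  · obtain ⟨a, -, _, ⟨_, rfl, e, he, rfl⟩, heq⟩ := by
      simpa only [Set.mem_iUnion₂, exists_prop] using hmem
    have heq := emb_injective d heq
    refine he.2.2 (Set.mem_iUnion₂.2 ⟨N, hN, fun i => a - f i, fun i => ?_, ?_⟩)
    · exact Finset.mem_coe.2 (Finset.mem_image_of_mem _ (hf i))
    · rw [Finset.sum_sub_distrib, ← heq]
      simp

section Simplex

variable {d : ℕ} {P : AffineBasis (Fin (d + 1)) ℝ (Fin d → ℝ)}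

lemma exists_isRep_of_mem_PA {A : Finset (Fin d → ℤ)} {p : Fin (d + 1) → Fin d → ℤ}
    (hp : ∀ k, P k = emb d (p k)) {i : Fin (d + 1)} {N : ℕ} {x : Fin d → ℤ}
    (h : N • p i - x ∈ PA d ↑(A.image fun a => p i - a)) :
    ∃ S, IsRep P (A \ Finset.univ.image p) i (x, N) S := by
  classical
  obtain ⟨K, -, hK⟩ := Set.mem_iUnion₂.1 h
  obtain ⟨f, hf, hsum⟩ := hK
  have hf' : ∀ j, p i - f j ∈ A := fun j => by
    obtain ⟨a, ha, hfa⟩ := Finset.mem_image.1 (Finset.mem_coe.1 (hf j))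
    rw [← hfa, sub_sub_cancel]
    exact ha
  let R : Multiset (Fin d → ℤ) := Finset.univ.val.map fun j => p i - f j
  have hRA : ∀ a ∈ R, a ∈ A := fun a ha => by
    obtain ⟨j, _, rfl⟩ := Multiset.mem_map.1 ha
    exact hf' j
  have hRsum : R.sum = K • p i - (N • p i - x) := by
    change ∑ j, (p i - f j) = _
    rw [Finset.sum_sub_distrib, ← hsum]
    simp
  have hxR : ((x, (N : ℤ)) : (Fin d → ℤ) × ℤ) = liftSum d R + ((N : ℤ) - K) • (p i, 1) := by
    rw [liftSum_eq, hRsum]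
    ext
    · simp
      ring
    · simp [R]
  let S := R.filter (· ∉ Set.range p)
  let Q := R.filter (· ∈ Set.range p)
  have hRSQ : R = S + Q := by
    rw [add_comm]
    exact (Multiset.filter_add_not _ R).symm
  choose n hn using exists_nat_homCoord_liftSum hp (S := Q) fun a ha => (Multiset.mem_filter.1 ha).2
  refine ⟨S, fun a ha => ?_, fun k => n k + (N - K) * if k = i then 1 else 0, fun k hk => ?_,
    fun k => ?_⟩
  · obtain ⟨haR, hap⟩ := Multiset.mem_filter.1 ha
    exact Finset.mem_sdiff.2 ⟨hRA a haR, by simpa using hap⟩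
  · simp [hk]
  · rw [hxR, map_add, map_zsmul, Pi.add_apply, Pi.smul_apply, homCoord_vertex hp, hRSQ, map_add,
      map_add, Pi.add_apply, hn]
    simp
    ring

end Simplex

/-- Effective structure theorem, simplex case: the structure equation holds once
`N ≥ (d+1)!·vol(H(A)) - (d+1)(|A|-d) + 1`. -/
theorem effective_structure_simplex (d : ℕ) (hd : 1 ≤ d)
    (A : Finset (Fin d → ℤ)) (hsimp : IsSimplex d A)
    (a0 : Fin d → ℤ) (ha0 : a0 ∈ A) :
    ∀ N : ℕ,
      ((d + 1).factorial : ℝ) * (volume (hull d A)).toReal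
          - (d + 1) * ((A.card : ℝ) - d) + 1 ≤ (N : ℝ) →
      structEq d A a0 N := by
  intro N hN
  obtain ⟨P, p, hp, hpA, hhull, hspan⟩ := exists_affineBasis_of_isSimplex hsimp
  set F := A \ Finset.univ.image p
  have hpinj : Function.Injective p := fun j k h => P.ind.injective (by
    rw [hp, hp, h])
  have hFcard : (A.card : ℝ) = F.card + (d + 1) := by
    have h := Finset.card_sdiff_add_card_eq_card
      (Finset.image_subset_iff.2 fun k (_ : k ∈ Finset.univ) => hpA k)
    rw [Finset.card_image_of_injective _ hpinj, Finset.card_univ, Fintype.card_fin] at h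
    exact_mod_cast h.symm
  have hA0 : ∀ a ∈ A, ∀ k, 0 ≤ P.coord k (emb d a) := fun a ha => by
    have : emb d a ∈ hull d A := subset_convexHull ℝ _ ⟨a, ha, rfl⟩
    rwa [hhull, P.convexHull_eq_nonneg_coord] at this
  have hF0 : ∀ a ∈ F, ∀ k, 0 ≤ P.coord k (emb d a) := fun a ha =>
    hA0 a (Finset.mem_sdiff.1 ha).1
  have hF1 : ∀ a ∈ F, ∀ k, P.coord k (emb d a) < 1 := fun a ha k =>
    coord_lt_one_of_ne (hF0 a ha) fun h => (Finset.mem_sdiff.1 ha).2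
      (Finset.mem_image.2 ⟨k, Finset.mem_univ k, emb_injective d (by rw [h, hp])⟩)
  set V : ℝ := d.factorial * (volume (hull d A)).toReal with hV
  have hbound : ∀ S, IsExchangeReduced P F S → ((F.card + 1 + (S.card - 1) : ℕ) : ℝ) ≤ V :=
    fun S hS => by
      rw [hV, hhull]
      exact card_add_card_le_of_isExchangeReduced hp hF0 hF1 hS
  have hNV : ((d : ℝ) + 1) * (V - F.card - 1) + 1 ≤ N := by
    rw [Nat.factorial_succ] at hN
    push_cast at hN
    rw [hFcard] at hN
    rw [hV]
    linarith
  have hN1 : 1 ≤ N := by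
    have h := hbound 0 fun T hT U _ _ hlt => by
      rw [Multiset.le_zero.1 hT] at hlt
      simp at hlt
    push_cast [Multiset.card_zero] at h
    have : (0 : ℝ) ≤ ((d : ℝ) + 1) * (V - F.card - 1) :=
      mul_nonneg (by positivity) (by simp at h; linarith)
    exact_mod_cast (show (1 : ℝ) ≤ N by linarith)
  refine Set.Subset.antisymm (nfold_subset ha0 hN1) ?_
  rintro _ ⟨⟨⟨y, hy, hxy⟩, ⟨_, ⟨_, rfl, z, hz, rfl⟩, rfl⟩⟩, hnot⟩
  set x := N • a0 + z with hx
  have hxy' : emb d x = (N : ℝ) • y := hxy.symm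
  rw [hhull, P.convexHull_eq_nonneg_coord] at hy
  refine ⟨x, ?_, rfl⟩
  obtain ⟨i, hi⟩ : ∃ i, (N : ℝ) ≤ (d + 1) * homCoord P (x, (N : ℤ)) i := by
    by_contra! hlt
    have h := Finset.sum_lt_sum_of_nonempty (Finset.univ_nonempty (α := Fin (d + 1)))
      fun k _ => hlt k
    rw [← Finset.mul_sum, sum_homCoord] at h
    simp at h
  have hPA : N • p i - x ∈ PA d ↑(A.image fun a => p i - a) := by
    by_contra hnPA
    refine hnot (Set.mem_iUnion₂.2 ⟨p i, vertex_mem_exP hd hhull hspan hp i, x,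
      ⟨N • p i, rfl, N • p i - x, ⟨smul_vertex_sub_mem_cone hp hpA hxy' hy (p i),
        nsmul_vertex_sub_mem_latt ha0 hz, hnPA⟩, ?_⟩, rfl⟩)
    simp
  obtain ⟨S₀, hS₀⟩ := exists_isRep_of_mem_PA hp hPA
  obtain ⟨S, ⟨hSF, m, hm, hrep⟩, hred⟩ := hS₀.exists_isExchangeReduced hF0 hF1
  refine mem_nfold_of_homCoord hp hpA (S := S) (fun a ha => (Finset.mem_sdiff.1 (hSF a ha)).1) m
    (fun k => ?_) hrep
  by_cases hk : k = i
  · subst hk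
    have hle := homCoord_liftSum_le_card (P := P) (S := S) (k := k)
      fun a ha => (hF1 a (hSF a ha) k).le
    have hmk := hrep k
    suffices (-1 : ℝ) < m k by
      have : -1 < m k := by exact_mod_cast this
      omega
    have hb := hbound S hred
    rcases Nat.eq_zero_or_pos S.card with h0 | hpos
    · have hnonneg : 0 ≤ homCoord P (x, (N : ℤ)) k := by
        rw [homCoord_smul P N x y hxy']
        exact mul_nonneg (Nat.cast_nonneg N) (hy k)
      rw [h0] at hle
      simp at hle
      linarith
    · have hcast : ((F.card + 1 + (S.card - 1) : ℕ) : ℝ) = F.card + S.card := by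
        rw [show F.card + 1 + (S.card - 1) = F.card + S.card by omega]
        push_cast
        rfl
      rw [hcast] at hb
      have hlt : ((d : ℝ) + 1) * (V - F.card - 1) < (d + 1) * homCoord P (x, (N : ℤ)) k := by
        linarith
      have := lt_of_mul_lt_mul_left hlt (by positivity)
      linarith
  · exact hm k hk
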